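/- (Minimal stabilisation.) Let X be a T0 core compact space with subbasis S, and define ⊢ on 𝖥S by F ⊢ G iff ⋂F ⋐ ⋃G. Let Y be a topological space and Z a stabilisation of Y, i.e. a stably locally compact space containing Y as a very dense subspace. Then every proximal map φ : Y → X has a unique proximal extension ψ : Z → 𝖳^S, namely a proximal map ψ with ψ(y) = S_{φ(y)} = {p ∈ S : φ(y) ∈ p} for all y ∈ Y. -/

import Mathlib

open scoped Classical

/-! Common definitions: entailment/cover relations on finite subsets,
tight subsets, the tight spectrum, quasi-ideals, and topological notions. -/

/-- `H` is a *selection* of the finite family `𝒢`: it meets every member of `𝒢`. -/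
def IsSelection {S : Type*} (𝒢 : Finset (Finset S)) (H : Finset S) : Prop :=
  ∀ I ∈ 𝒢, ∃ x ∈ I, x ∈ H

/-- Cut-composition `r • s` of relations. -/
def CutComp {A B C : Type*} (r : Finset A → Finset B → Prop)
    (s : Finset B → Finset C → Prop) (F : Finset A) (G : Finset C) : Prop :=
  ∃ ℱ 𝒢 : Finset (Finset B),
    (∀ H ∈ ℱ, r F H) ∧
    (∀ K : Finset B, IsSelection ℱ K → ∃ I ∈ 𝒢, I ⊆ K) ∧
    (∀ I ∈ 𝒢, s I G)

/-- Upper relation: `F ⊢ G ⊆ H` implies `F ⊢ H`. -/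
def IsUpperRel {A B : Type*} (r : Finset A → Finset B → Prop) : Prop :=
  ∀ F G H, r F G → G ⊆ H → r F H

/-- Lower relation: `F ⊢ G` and `F ⊆ E` imply `E ⊢ G`. -/
def IsLowerRel {A B : Type*} (r : Finset A → Finset B → Prop) : Prop :=
  ∀ F G E, r F G → F ⊆ E → r E G

/-- `F ⊢_{1∃} G` iff `F ⊢ {g}` for some `g ∈ G`. -/
def OneExists {A B : Type*} (r : Finset A → Finset B → Prop)
    (F : Finset A) (G : Finset B) : Prop :=
  ∃ g ∈ G, r F {g}

/-- Cut-transitivity: `⊢ • ⊢ ⊆ ⊢`. -/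
def CutTransitive {S : Type*} (r : Finset S → Finset S → Prop) : Prop :=
  ∀ F G, CutComp r r F G → r F G

/-- Divisibility: `⊢ ⊆ ⊢ • ⊢_{1∃}`. -/
def Divisible {S : Type*} (r : Finset S → Finset S → Prop) : Prop :=
  ∀ F G, r F G → CutComp r (OneExists r) F G

/-- A strong idempotent: monotone, cut-transitive and divisible. -/
def StrongIdempotent {S : Type*} (r : Finset S → Finset S → Prop) : Prop :=
  IsUpperRel r ∧ IsLowerRel r ∧ CutTransitive r ∧ Divisible r

/-- Gentzen's cut rule. -/
def CutRel {S : Type*} (r : Finset S → Finset S → Prop) : Prop :=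
  ∀ (s : S) (F G : Finset S), r (insert s F) G → r F (insert s G) → r F G

/-- An entailment: a monotone cut relation. -/
def Entailment {S : Type*} (r : Finset S → Finset S → Prop) : Prop :=
  IsUpperRel r ∧ IsLowerRel r ∧ CutRel r

/-- 1-reflexivity: `{s} ⊢ {s}` for all `s`. -/
def OneReflexive {S : Type*} (r : Finset S → Finset S → Prop) : Prop :=
  ∀ s : S, r {s} {s}

/-- The relation `⊩` induced by `⊢`:
`F ⊩ G` iff every `H` with `H ⊢ {f}` for all `f ∈ F` satisfies `H ⊢ G`. -/
def Vdash {S : Type*} (r : Finset S → Finset S → Prop)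
    (F G : Finset S) : Prop :=
  ∀ H : Finset S, (∀ f ∈ F, r H {f}) → r H G

/-- `⊢` is auxiliary to `⊨`. -/
def AuxiliaryTo {S T : Type*} (r : Finset S → Finset T → Prop)
    (v : Finset S → Finset S → Prop) : Prop :=
  ∀ (F H : Finset S) (G : Finset T), (∀ h ∈ H, r (insert h F) G) → v F H → r F G

/-- `⊢` is dual-auxiliary to `⊨`. -/
def DualAuxiliaryTo {S : Type*} (r v : Finset S → Finset S → Prop) : Prop :=
  ∀ F G H : Finset S, r H G → (∀ h ∈ H, v F (insert h G)) → r F G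

/-- A semicut relation: self-dual-auxiliary. -/
def Semicut {S : Type*} (r : Finset S → Finset S → Prop) : Prop :=
  DualAuxiliaryTo r r

/-- A cover relation: a strong idempotent auxiliary to `⊩`. -/
def CoverRelation {S : Type*} (r : Finset S → Finset S → Prop) : Prop :=
  StrongIdempotent r ∧ AuxiliaryTo r (Vdash r)

/-- Tight subset. -/
def TightSet {S : Type*} (r : Finset S → Finset S → Prop) (T : Set S) : Prop :=
  ∀ G : Finset S, (∃ F : Finset S, ↑F ⊆ T ∧ r F G) ↔ ∃ g ∈ G, g ∈ T

/-- Round subset. -/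
def RoundSet {S : Type*} (r : Finset S → Finset S → Prop) (R : Set S) : Prop :=
  ∀ x ∈ R, ∃ F : Finset S, ↑F ⊆ R ∧ r F {x}

/-- Prime subset. -/
def PrimeSet {S : Type*} (r : Finset S → Finset S → Prop) (P : Set S) : Prop :=
  ∀ F G : Finset S, ↑F ⊆ P → r F G → ∃ g ∈ G, g ∈ P

/-- The tight spectrum: nonempty tight subsets. -/
def TightSpec {S : Type*} (r : Finset S → Finset S → Prop) : Type _ :=
  {T : Set S // TightSet r T ∧ T.Nonempty}

/-- The underlying set of points of an element of the tight spectrum. -/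
def TightSpec.pts {S : Type*} {r : Finset S → Finset S → Prop} (T : TightSpec r) : Set S :=
  Subtype.val T

/-- The spectrum topology, generated by the subbasic sets `𝖳_p = {T | p ∈ T}`. -/
instance TightSpec.instTopologicalSpace {S : Type*} (r : Finset S → Finset S → Prop) :
    TopologicalSpace (TightSpec r) :=
  TopologicalSpace.generateFrom (Set.range fun p : S => {T : TightSpec r | p ∈ T.pts})

/-- `𝖳_F = {T ∈ 𝖳^S : F ⊆ T}`. -/
def TightSpec.TF {S : Type*} (r : Finset S → Finset S → Prop) (F : Finset S) :
    Set (TightSpec r) :=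
  {T : TightSpec r | ↑F ⊆ T.pts}

/-- `𝖳^G = {T ∈ 𝖳^S : T ∩ G ≠ ∅}`. -/
def TightSpec.TG {S : Type*} (r : Finset S → Finset S → Prop) (G : Finset S) :
    Set (TightSpec r) :=
  {T : TightSpec r | ∃ g ∈ G, g ∈ T.pts}

/-- `p ⋐ q`: every open cover of `q` has a finite subcover of `p`. -/
def CompactlyContained {X : Type*} [TopologicalSpace X] (p q : Set X) : Prop :=
  ∀ 𝒰 : Set (Set X), (∀ u ∈ 𝒰, IsOpen u) → q ⊆ ⋃₀ 𝒰 →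
    ∃ 𝒱 : Finset (Set X), ↑𝒱 ⊆ 𝒰 ∧ p ⊆ ⋃₀ ↑𝒱

/-- Core compactness. -/
def CoreCompact (X : Type*) [TopologicalSpace X] : Prop :=
  ∀ p : Set X, IsOpen p → ∀ x ∈ p, ∃ q : Set X, IsOpen q ∧ x ∈ q ∧ CompactlyContained q p

/-- Core coherence. -/
def CoreCoherent (X : Type*) [TopologicalSpace X] : Prop :=
  ∀ p q s : Set X, IsOpen p → IsOpen q → IsOpen s →
    CompactlyContained p q → CompactlyContained p s → CompactlyContained p (q ∩ s)

/-- Sobriety: each irreducible closed set is the closure of a unique point. -/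
def SoberSpace (X : Type*) [TopologicalSpace X] : Prop :=
  ∀ C : Set X, IsIrreducible C → IsClosed C → ∃! x : X, C = closure {x}

/-- Stably locally compact: core compact, core coherent and sober. -/
def StablyLocallyCompact (X : Type*) [TopologicalSpace X] : Prop :=
  CoreCompact X ∧ CoreCoherent X ∧ SoberSpace X

/-- The specialisation preorder: `x → y` iff every open set containing `y` contains `x`. -/
def SpecTo {X : Type*} [TopologicalSpace X] (x y : X) : Prop :=
  ∀ U : Set X, IsOpen U → y ∈ U → x ∈ U

/-- Saturation of a subset. -/
def satOf {X : Type*} [TopologicalSpace X] (D : Set X) : Set X :=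
  {x | ∃ y ∈ D, SpecTo x y}

/-- Saturated subsets. -/
def IsSaturatedSet {X : Type*} [TopologicalSpace X] (K : Set X) : Prop :=
  K = satOf K

/-- The patch topology: generated by open sets together with complements of
compact saturated sets. -/
def patchTopology (X : Type*) [TopologicalSpace X] : TopologicalSpace X :=
  TopologicalSpace.generateFrom
    ({U : Set X | IsOpen U} ∪ {V : Set X | ∃ K : Set X, IsCompact K ∧ IsSaturatedSet K ∧ V = Kᶜ})

/-- Very dense subset: the whole space is both its saturation and its patch-closure. -/
def VeryDense {X : Type*} [TopologicalSpace X] (D : Set X) : Prop :=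
  satOf D = Set.univ ∧ @Dense X (patchTopology X) D

/-- A subbasis: a covering family of open sets generating the topology. -/
def IsSubbasis {X : Type*} [t : TopologicalSpace X] (S : Set (Set X)) : Prop :=
  (∀ p ∈ S, IsOpen p) ∧ ⋃₀ S = Set.univ ∧ TopologicalSpace.generateFrom S = t

/-- The compact cover relation `⊢_⋐` on the finite subsets of a family `S` of
subsets of a space `X`: `F ⊢ G` iff `⋂F ⋐ ⋃G`. -/
def subCover {X : Type*} [TopologicalSpace X] (S : Set (Set X)) :
    Finset ↥S → Finset ↥S → Prop := fun F G =>
  CompactlyContained (⋂ p ∈ F, (p : Set X)) (⋃ p ∈ G, (p : Set X))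

/-- `∩`-roundness of a family of open sets. -/
def CapRound {X : Type*} [TopologicalSpace X] (S : Set (Set X)) : Prop :=
  ∀ p ∈ S, ∀ x ∈ p, ∃ F : Finset ↥S,
    x ∈ (⋂ q ∈ F, (q : Set X)) ∧ CompactlyContained (⋂ q ∈ F, (q : Set X)) p

/-- A pseudosubbasis: a `∩`-round, `T0`-separating family of open sets. -/
def IsPseudoSubbasis {X : Type*} [TopologicalSpace X] (S : Set (Set X)) : Prop :=
  (∀ p ∈ S, IsOpen p) ∧ CapRound S ∧
    ∀ x y : X, x ≠ y → ∃ p ∈ S, (x ∈ p ∧ y ∉ p) ∨ (y ∈ p ∧ x ∉ p)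

/-- A proximal map: continuous and preserving compact containment under preimages. -/
def Proximal {Y X : Type*} [TopologicalSpace Y] [TopologicalSpace X] (φ : Y → X) : Prop :=
  Continuous φ ∧ ∀ O N : Set X, IsOpen O → IsOpen N →
    CompactlyContained O N → CompactlyContained (φ ⁻¹' O) (φ ⁻¹' N)

/-- `𝒬↓`: the finite sets `F` with `F ⊢ 𝒢_⋔` for some finite `𝒢 ⊆ 𝒬`. -/
def downSet {S : Type*} (r : Finset S → Finset S → Prop) (Q : Set (Finset S)) :
    Set (Finset S) :=
  {F | ∃ 𝒢 : Finset (Finset S), ↑𝒢 ⊆ Q ∧ ∀ H : Finset S, IsSelection 𝒢 H → r F H}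

/-- Quasi-ideal: `𝒬 = 𝒬↓`. -/
def QuasiIdeal {S : Type*} (r : Finset S → Finset S → Prop) (Q : Set (Finset S)) : Prop :=
  downSet r Q = Q

/-- `G^⊣ = {F : F ⊢ G}`. -/
def polar {S : Type*} (r : Finset S → Finset S → Prop) (G : Finset S) : Set (Finset S) :=
  {F | r F G}

/-- The way-below relation in the complete lattice of quasi-ideals (where the join
of a family `𝒟` is `(⋃₀𝒟)↓`): `Q ≪ R` iff every nonempty directed family of
quasi-ideals whose join contains `R` has a member containing `Q`. -/
def WayBelowQI {S : Type*} (r : Finset S → Finset S → Prop)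
    (Q R : Set (Finset S)) : Prop :=
  ∀ 𝒟 : Set (Set (Finset S)), (∀ P ∈ 𝒟, QuasiIdeal r P) → 𝒟.Nonempty →
    DirectedOn (· ⊆ ·) 𝒟 → R ⊆ downSet r (⋃₀ 𝒟) → ∃ P ∈ 𝒟, Q ⊆ P

namespace CompactlyContained

variable {X : Type*} [TopologicalSpace X]

theorem mono {p p' q q' : Set X} (h : CompactlyContained p q) (hp : p' ⊆ p) (hq : q ⊆ q') :
    CompactlyContained p' q' := fun 𝒰 ho hc =>
  let ⟨𝒱, h𝒱, hp𝒱⟩ := h 𝒰 ho (hq.trans hc)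
  ⟨𝒱, h𝒱, hp.trans hp𝒱⟩

theorem subset {p q : Set X} (h : CompactlyContained p q) (hq : IsOpen q) : p ⊆ q := by
  obtain ⟨𝒱, h𝒱, hp⟩ := h {q} (by simpa using hq) (by simp)
  intro x hx
  obtain ⟨v, hv, hxv⟩ := hp hx
  have hvq : v = q := h𝒱 hv
  exact hvq ▸ hxv

theorem empty (q : Set X) : CompactlyContained ∅ q :=
  fun _ _ _ => ⟨∅, by simp, by simp⟩

theorem union {p p' q : Set X} (h : CompactlyContained p q) (h' : CompactlyContained p' q) :
    CompactlyContained (p ∪ p') q := by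
  intro 𝒰 ho hc
  obtain ⟨𝒱, h𝒱, hp⟩ := h 𝒰 ho hc
  obtain ⟨𝒱', h𝒱', hp'⟩ := h' 𝒰 ho hc
  refine ⟨𝒱 ∪ 𝒱', by simp [h𝒱, h𝒱'], ?_⟩
  rw [Finset.coe_union, Set.sUnion_union]
  exact Set.union_subset_union hp hp'

theorem sUnion {𝒱 : Finset (Set X)} {q : Set X} (h : ∀ v ∈ 𝒱, CompactlyContained v q) :
    CompactlyContained (⋃₀ (𝒱 : Set (Set X))) q := by
  induction 𝒱 using Finset.induction_on with
  | empty => simpa using empty q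
  | insert v 𝒱 _ ih =>
    rw [Finset.coe_insert, Set.sUnion_insert]
    exact (h v (by simp)).union (ih fun w hw => h w (by simp [hw]))

/-- Compact containment only has to be tested on covers that are locally given. -/
theorem exists_finset {p q : Set X} (h : CompactlyContained p q) {P : Set X → Prop}
    (hP : ∀ x ∈ q, ∃ u, IsOpen u ∧ x ∈ u ∧ P u) :
    ∃ 𝒱 : Finset (Set X), (∀ v ∈ 𝒱, IsOpen v ∧ P v) ∧ p ⊆ ⋃₀ (𝒱 : Set (Set X)) :=
  let ⟨𝒱, h𝒱, hp⟩ := h {u | IsOpen u ∧ P u} (fun _ hu => hu.1) fun x hx =>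
    let ⟨u, hu, hxu, hPu⟩ := hP x hx
    ⟨u, ⟨hu, hPu⟩, hxu⟩
  ⟨𝒱, fun _ hv => h𝒱 hv, hp⟩

theorem biInter_of_coreCoherent (hX : CoreCoherent X) {β : Type*} {p : Set X} (hp : IsOpen p)
    {s : β → Set X} (hs : ∀ b, IsOpen (s b)) {F : Finset β} (hF : F.Nonempty)
    (h : ∀ b ∈ F, CompactlyContained p (s b)) : CompactlyContained p (⋂ b ∈ F, s b) := by
  induction hF using Finset.Nonempty.cons_induction with
  | singleton b => simpa using h
  | cons b F _ _ ih =>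
    rw [Finset.cons_eq_insert, Finset.set_biInter_insert]
    exact hX p _ _ hp (hs b) (isOpen_biInter_finset fun c _ => hs c) (h b (by simp))
      (ih fun c hc => h c (by simp [hc]))

end CompactlyContained

section CoreCompact

variable {X : Type*} [TopologicalSpace X]

theorem CoreCompact.interpolate (hX : CoreCompact X) {p q : Set X} (hq : IsOpen q)
    (h : CompactlyContained p q) :
    ∃ r, IsOpen r ∧ CompactlyContained p r ∧ CompactlyContained r q := by
  obtain ⟨𝒱, h𝒱, hp⟩ := h.exists_finset
    (P := fun u => ∃ r, IsOpen r ∧ CompactlyContained u r ∧ CompactlyContained r q)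
    fun x hx => by
      obtain ⟨r, hr, hxr, hrq⟩ := hX q hq x hx
      obtain ⟨u, hu, hxu, hur⟩ := hX r hr x hxr
      exact ⟨u, hu, hxu, r, hr, hur, hrq⟩
  choose! r hr using fun v hv => (h𝒱 v hv).2
  refine ⟨⋃₀ (𝒱.image r : Finset (Set X)), isOpen_sUnion ?_,
    (CompactlyContained.sUnion fun v hv => ?_).mono hp subset_rfl,
    CompactlyContained.sUnion fun v hv => ?_⟩
  · intro t ht
    obtain ⟨v, hv, rfl⟩ := Finset.mem_image.1 ht
    exact (hr v hv).1
  · exact (hr v hv).2.1.mono subset_rfl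
      (Set.subset_sUnion_of_mem (Finset.mem_image_of_mem r hv))
  · obtain ⟨w, hw, rfl⟩ := Finset.mem_image.1 hv
    exact (hr w hw).2.2

/-- A decreasing sequence interpolating between two open sets, one compactly contained in the
other. -/
theorem CoreCompact.exists_seq (hX : CoreCompact X) {p q : Set X} (hq : IsOpen q)
    (h : CompactlyContained p q) :
    ∃ v : ℕ → Set X, v 0 = q ∧ (∀ n, IsOpen (v n)) ∧ (∀ n, p ⊆ v n) ∧
      ∀ n, CompactlyContained (v (n + 1)) (v n) := by
  choose f hf using fun r : {r : Set X // IsOpen r ∧ CompactlyContained p r} =>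
    hX.interpolate r.2.1 r.2.2
  let w : ℕ → {r : Set X // IsOpen r ∧ CompactlyContained p r} := fun n =>
    Nat.rec ⟨q, hq, h⟩ (fun _ r => ⟨f r, (hf r).1, (hf r).2.1⟩) n
  exact ⟨fun n => (w n).1, rfl, fun n => (w n).2.1, fun n => (w n).2.2.subset (w n).2.1,
    fun n => (hf (w n)).2.2⟩

/-- The Hofmann–Mislove argument for the filter generated by a decreasing sequence of open sets,
each compactly contained in the previous one. -/
theorem SoberSpace.exists_seq_subset (hX : SoberSpace X) {v : ℕ → Set X}
    (hvo : ∀ n, IsOpen (v n)) (hv : ∀ n, CompactlyContained (v (n + 1)) (v n)) {U : Set X}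
    (hU : IsOpen U) (hK : ⋂ n, v n ⊆ U) : ∃ n, v n ⊆ U := by
  have hanti : Antitone v := antitone_nat_of_succ_le fun n => (hv n).subset (hvo n)
  by_contra hn
  obtain ⟨M, hUM, hM⟩ := zorn_subset_nonempty {W : Set X | IsOpen W ∧ ¬ ∃ n, v n ⊆ W}
    (fun c hc hchain hne => by
      refine ⟨⋃₀ c, ⟨isOpen_sUnion fun t ht => (hc ht).1, ?_⟩,
        fun s hs => Set.subset_sUnion_of_mem hs⟩
      rintro ⟨n, hn⟩
      obtain ⟨𝒱, h𝒱, hsub⟩ := hv n c (fun t ht => (hc ht).1) hn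
      obtain ⟨t, ht, hcov⟩ := Finset.sup_le_of_le_directed c hne hchain.directedOn 𝒱
        fun u hu => ⟨u, h𝒱 hu, le_rfl⟩
      rw [Finset.sup_id_set_eq_sUnion] at hcov
      exact (hc ht).2 ⟨n + 1, hsub.trans hcov⟩)
    U ⟨hU, hn⟩
  have key : ∀ A, IsOpen A → (Mᶜ ∩ A).Nonempty → ∃ n, v n ⊆ M ∪ A := by
    intro A hA ⟨x, hxM, hxA⟩
    by_contra hcon
    exact hxM (hM.2 ⟨hM.1.1.union hA, hcon⟩ Set.subset_union_left (Or.inr hxA))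
  have hirr : IsIrreducible Mᶜ := by
    refine ⟨?_, fun A B hA hB hMA hMB => ?_⟩
    · by_contra hemp
      rw [Set.not_nonempty_iff_eq_empty, Set.compl_empty_iff] at hemp
      exact hM.1.2 ⟨0, by simp [hemp]⟩
    · obtain ⟨n, hn⟩ := key A hA hMA
      obtain ⟨m, hm⟩ := key B hB hMB
      by_contra hcon
      refine hM.1.2 ⟨max n m, fun x hx => ?_⟩
      by_contra hxM
      refine hcon ⟨x, hxM, (hn (hanti (le_max_left n m) hx)).resolve_left hxM,
        (hm (hanti (le_max_right n m) hx)).resolve_left hxM⟩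
  obtain ⟨x, hx, -⟩ := hX Mᶜ hirr hM.1.1.isClosed_compl
  have hxM : x ∈ Mᶜ := hx ▸ subset_closure rfl
  refine hxM (hUM (hK (Set.mem_iInter.2 fun n => ?_)))
  by_contra hxn
  refine hM.1.2 ⟨n, ?_⟩
  have : closure {x} ⊆ (v n)ᶜ :=
    closure_minimal (Set.singleton_subset_iff.2 hxn) (hvo n).isClosed_compl
  rw [← hx] at this
  exact Set.compl_subset_compl.1 this

theorem exists_isCompact_isSaturatedSet_between (hX : CoreCompact X) (hs : SoberSpace X)
    {p q : Set X} (hq : IsOpen q) (h : CompactlyContained p q) :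
    ∃ K, IsCompact K ∧ IsSaturatedSet K ∧ p ⊆ K ∧ K ⊆ q := by
  obtain ⟨v, rfl, hvo, hpv, hv⟩ := hX.exists_seq hq h
  refine ⟨⋂ n, v n, ?_, ?_, Set.subset_iInter hpv, Set.iInter_subset v 0⟩
  · refine isCompact_of_finite_subcover fun {i} W hW hcov => ?_
    obtain ⟨n, hn⟩ := hs.exists_seq_subset hvo hv (isOpen_iUnion hW) hcov
    obtain ⟨𝒱, h𝒱, hsub⟩ := hv n (Set.range W) (by rintro _ ⟨j, rfl⟩; exact hW j)
      (by rwa [Set.sUnion_range])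
    rw [← Set.image_univ] at h𝒱
    obtain ⟨t, -, rfl⟩ := Finset.subset_set_image_iff.1 h𝒱
    refine ⟨t, (Set.iInter_subset v (n + 1)).trans (hsub.trans ?_)⟩
    rintro x ⟨w, hw, hxw⟩
    obtain ⟨j, hj, rfl⟩ := Finset.mem_image.1 hw
    exact Set.mem_biUnion hj hxw
  · refine Set.Subset.antisymm (fun x hx => ⟨x, hx, fun _ _ h => h⟩) ?_
    rintro x ⟨y, hy, hxy⟩
    exact Set.mem_iInter.2 fun n => hxy _ (hvo n) (Set.mem_iInter.1 hy n)

theorem subset_of_patch_dense (hX : CoreCompact X) (hs : SoberSpace X) {D : Set X}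
    (hD : @Dense X (patchTopology X) D) {U V V' : Set X} (hU : IsOpen U) (hV' : IsOpen V')
    (h : CompactlyContained V V') (hUV : U ∩ D ⊆ V) : U ⊆ V' := by
  obtain ⟨K, hK, hKs, hVK, hKV⟩ := exists_isCompact_isSaturatedSet_between hX hs hV' h
  by_contra hn
  obtain ⟨x, hxU, hxV⟩ := Set.not_subset.1 hn
  have hopen : @IsOpen X (patchTopology X) (U ∩ Kᶜ) :=
    @IsOpen.inter X (patchTopology X) U Kᶜ
      (TopologicalSpace.isOpen_generateFrom_of_mem (Or.inl hU))
      (TopologicalSpace.isOpen_generateFrom_of_mem (Or.inr ⟨K, hK, hKs, rfl⟩))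
  obtain ⟨y, ⟨hyU, hyK⟩, hyD⟩ := @Dense.inter_open_nonempty X (patchTopology X) D hD
    (U ∩ Kᶜ) hopen ⟨x, hxU, fun hx => hxV (hKV hx)⟩
  exact hyK (hVK (hUV ⟨hyU, hyD⟩))

end CoreCompact

section VeryDense

variable {X Y Z : Type*} [TopologicalSpace X] [TopologicalSpace Z]

/-- The extension to `Z` of the preimage under `φ` of an open set of `X`. -/
def extendedPreimage (ι : Y → Z) (φ : Y → X) (O : Set X) : Set Z :=
  ⋃₀ {U | IsOpen U ∧ ∃ O', IsOpen O' ∧ CompactlyContained O' O ∧ ι ⁻¹' U ⊆ φ ⁻¹' O'}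

theorem isOpen_extendedPreimage (ι : Y → Z) (φ : Y → X) (O : Set X) :
    IsOpen (extendedPreimage ι φ O) :=
  isOpen_sUnion fun _ h => h.1

variable [TopologicalSpace Y]

/-- Compact containment in a patch-dense subspace lifts to the whole space. -/
theorem CompactlyContained.of_preimage (hZ : CoreCompact Z) (hs : SoberSpace Z) {ι : Y → Z}
    (hι : Continuous ι) (hD : @Dense Z (patchTopology Z) (Set.range ι)) {U V : Set Z}
    (hU : IsOpen U) (h : CompactlyContained (ι ⁻¹' U) (ι ⁻¹' V)) : CompactlyContained U V := by
  intro 𝒰 ho hc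
  obtain ⟨𝒱, h𝒱, hsub⟩ := h.exists_finset
    (P := fun v => ∃ w, ∃ u ∈ 𝒰, CompactlyContained w u ∧ v ⊆ ι ⁻¹' w) fun y hy => by
      obtain ⟨u, hu, hyu⟩ := hc hy
      obtain ⟨w, hw, hyw, hwu⟩ := hZ u (ho u hu) _ hyu
      exact ⟨ι ⁻¹' w, hw.preimage hι, hyw, w, u, hu, hwu, subset_rfl⟩
  choose! w u hu using fun v hv => (h𝒱 v hv).2
  have huo : ↑(𝒱.image u) ⊆ 𝒰 := by
    intro t ht
    obtain ⟨v, hv, rfl⟩ := Finset.mem_image.1 ht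
    exact (hu v hv).1
  refine ⟨𝒱.image u, huo, subset_of_patch_dense hZ hs hD
    (V := ⋃₀ (𝒱.image w : Finset (Set Z))) hU (isOpen_sUnion fun t ht => ho t (huo ht))
    (CompactlyContained.sUnion fun t ht => ?_) ?_⟩
  · obtain ⟨v, hv, rfl⟩ := Finset.mem_image.1 ht
    exact (hu v hv).2.1.mono subset_rfl
      (Set.subset_sUnion_of_mem (Finset.mem_image_of_mem u hv))
  · rintro _ ⟨hyU, y, rfl⟩
    obtain ⟨v, hv, hyv⟩ := hsub hyU
    exact ⟨w v, Finset.mem_image_of_mem w hv, (hu v hv).2.2 hyv⟩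

/-- An open set whose trace lies in `φ ⁻¹' O` is compactly contained in every open set whose trace
contains `φ ⁻¹' N`, when `O ⋐ N`. -/
theorem Proximal.compactlyContained_of_trace {φ : Y → X} (hφ : Proximal φ) (hZ : CoreCompact Z)
    (hs : SoberSpace Z) {ι : Y → Z} (hι : Continuous ι)
    (hD : @Dense Z (patchTopology Z) (Set.range ι)) {U V : Set Z} (hU : IsOpen U) {O N : Set X}
    (hO : IsOpen O) (hN : IsOpen N) (h : CompactlyContained O N) (hUO : ι ⁻¹' U ⊆ φ ⁻¹' O)
    (hNV : φ ⁻¹' N ⊆ ι ⁻¹' V) : CompactlyContained U V :=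
  .of_preimage hZ hs hι hD hU ((hφ.2 O N hO hN h).mono hUO hNV)

theorem preimage_extendedPreimage (hX : CoreCompact X) {ι : Y → Z}
    (hι : Topology.IsInducing ι) {φ : Y → X} (hφ : Continuous φ) {O : Set X} (hO : IsOpen O) :
    ι ⁻¹' extendedPreimage ι φ O = φ ⁻¹' O := by
  ext y
  constructor
  · rintro ⟨U, ⟨-, O', -, hO'O, hU⟩, hy⟩
    exact hO'O.subset hO (hU hy)
  · intro hy
    obtain ⟨O', hO', hyO', hO'O⟩ := hX O hO _ hy
    obtain ⟨U, hU, hUO'⟩ := hι.isOpen_iff.1 (hO'.preimage hφ)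
    refine ⟨U, ⟨hU, O', hO', hO'O, hUO'.subset⟩, ?_⟩
    change y ∈ ι ⁻¹' U
    rw [hUO']
    exact hyO'

end VeryDense

theorem TopologicalSpace.exists_finset_of_isOpen_generateFrom {α β : Type*} {s : β → Set α}
    {N : Set α} (hN : @IsOpen α (TopologicalSpace.generateFrom (Set.range s)) N) {x : α}
    (hx : x ∈ N) : ∃ F : Finset β, x ∈ ⋂ b ∈ F, s b ∧ ⋂ b ∈ F, s b ⊆ N := by
  induction hN with
  | basic u hu =>
    obtain ⟨b, rfl⟩ := hu
    exact ⟨{b}, by simpa using hx, by simp⟩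
  | univ => exact ⟨∅, by simp, by simp⟩
  | inter u v _ _ ihu ihv =>
    obtain ⟨F, hF, hFu⟩ := ihu hx.1
    obtain ⟨G, hG, hGv⟩ := ihv hx.2
    rw [Set.mem_iInter₂] at hF hG
    refine ⟨F ∪ G, Set.mem_iInter₂.2 fun b hb => (Finset.mem_union.1 hb).elim (hF b) (hG b),
      Set.subset_inter (Set.Subset.trans ?_ hFu) (Set.Subset.trans ?_ hGv)⟩
    · exact Set.biInter_subset_biInter_left fun b hb => Finset.mem_union_left G hb
    · exact Set.biInter_subset_biInter_left fun b hb => Finset.mem_union_right F hb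
  | sUnion 𝒰 _ ih =>
    obtain ⟨u, hu, hxu⟩ := hx
    obtain ⟨F, hF, hFu⟩ := ih u hu hxu
    exact ⟨F, hF, hFu.trans (Set.subset_sUnion_of_mem hu)⟩

theorem IsSubbasis.exists_finset {X : Type*} [TopologicalSpace X] {S : Set (Set X)}
    (hS : IsSubbasis S) {N : Set X} (hN : IsOpen N) {x : X} (hx : x ∈ N) :
    ∃ F : Finset S, x ∈ ⋂ p ∈ F, (p : Set X) ∧ ⋂ p ∈ F, (p : Set X) ⊆ N := by
  refine TopologicalSpace.exists_finset_of_isOpen_generateFrom ?_ hx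
  rwa [Subtype.range_coe, hS.2.2]

namespace TightSpec

variable {S : Type*} {r : Finset S → Finset S → Prop}

theorem isOpen_setOf_mem (p : S) : IsOpen {T : TightSpec r | p ∈ T.pts} :=
  TopologicalSpace.isOpen_generateFrom_of_mem ⟨p, rfl⟩

theorem exists_entails_of_mem (T : TightSpec r) {p : S} (hp : p ∈ T.pts) :
    ∃ F : Finset S, ↑F ⊆ T.pts ∧ r F {p} :=
  (T.2.1 {p}).2 ⟨p, by simp, hp⟩

theorem isOpen_TF (F : Finset S) : IsOpen (TF r F) := by
  have : TF r F = ⋂ p ∈ F, {T : TightSpec r | p ∈ T.pts} := by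
    ext T
    simp [TF, Set.subset_def]
  rw [this]
  exact isOpen_biInter_finset fun p _ => isOpen_setOf_mem p

theorem exists_TF_subset {N : Set (TightSpec r)} (hN : IsOpen N) {T : TightSpec r}
    (hT : T ∈ N) : ∃ F : Finset S, F.Nonempty ∧ T ∈ TF r F ∧ TF r F ⊆ N := by
  obtain ⟨F, hF, hFN⟩ := TopologicalSpace.exists_finset_of_isOpen_generateFrom
    (s := fun p : S => {T : TightSpec r | p ∈ T.pts}) hN hT
  obtain ⟨p, hp⟩ := T.2.2
  rw [Set.mem_iInter₂] at hF
  refine ⟨insert p F, by simp, fun q hq => ?_, fun T' hT' => hFN (Set.mem_iInter₂.2 fun q hq => ?_)⟩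
  · rcases Finset.mem_insert.1 hq with rfl | hq
    exacts [hp, hF q hq]
  · exact hT' (Finset.mem_insert_of_mem hq)

end TightSpec

section Extension

variable {X Y Z : Type*} [TopologicalSpace X] [TopologicalSpace Y] [TopologicalSpace Z]

theorem tightSet_extendedPreimage (hX : CoreCompact X) {S : Set (Set X)} (hS : IsSubbasis S)
    {ι : Y → Z} (hι : Topology.IsInducing ι) (hZ : CoreCompact Z) (hs : SoberSpace Z)
    (hD : @Dense Z (patchTopology Z) (Set.range ι)) {φ : Y → X} (hφ : Proximal φ) (z : Z) :
    TightSet (subCover S) {p : S | z ∈ extendedPreimage ι φ p} := by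
  have hE := fun p : S => preimage_extendedPreimage hX hι hφ.1 (hS.1 p p.2)
  have hint : ∀ F : Finset S, IsOpen (⋂ p ∈ F, (p : Set X)) := fun F =>
    isOpen_biInter_finset fun p _ => hS.1 p p.2
  have hEint : ∀ F : Finset S, ι ⁻¹' (⋂ p ∈ F, extendedPreimage ι φ p) =
      φ ⁻¹' ⋂ p ∈ F, (p : Set X) := fun F => by
    simp only [Set.preimage_iInter, hE]
  have hEo : ∀ F : Finset S, IsOpen (⋂ p ∈ F, extendedPreimage ι φ (p : Set X)) := fun F =>
    isOpen_biInter_finset fun p _ => isOpen_extendedPreimage ι φ p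
  intro G
  constructor
  · rintro ⟨F, hF, hFG⟩
    have hFG' : CompactlyContained (⋂ p ∈ F, extendedPreimage ι φ (p : Set X))
        (⋃ p ∈ G, extendedPreimage ι φ (p : Set X)) :=
      hφ.compactlyContained_of_trace hZ hs hι.continuous hD (hEo F) (hint F)
        (N := ⋃ p ∈ G, (p : Set X))
        (isOpen_biUnion fun p _ => hS.1 p p.2) hFG (hEint F).subset
        (by simp only [Set.preimage_iUnion, hE, subset_rfl])
    have := hFG'.subset (isOpen_biUnion fun p _ => isOpen_extendedPreimage ι φ p)
      (Set.mem_iInter₂.2 fun p hp => hF hp)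
    simpa using this
  · rintro ⟨p, hpG, U, ⟨hU, O, hO, hOp, hUO⟩, hzU⟩
    obtain ⟨N, hN, hON, hNp⟩ := hX.interpolate (hS.1 p p.2) hOp
    have hpG' : (p : Set X) ⊆ ⋃ q ∈ G, (q : Set X) :=
      Set.subset_biUnion_of_mem (u := fun q : S => (q : Set X)) hpG
    have hUV : CompactlyContained U (⋃ F ∈ {F : Finset S | ⋂ q ∈ F, (q : Set X) ⊆ N},
        ⋂ q ∈ F, extendedPreimage ι φ (q : Set X)) := by
      refine hφ.compactlyContained_of_trace hZ hs hι.continuous hD hU hO hN hON hUO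
        fun y hy => ?_
      obtain ⟨F, hyF, hFN⟩ := hS.exists_finset hN hy
      refine Set.mem_biUnion (x := F) hFN ?_
      exact (hEint F).symm.subset hyF
    obtain ⟨F, hFN, hzF⟩ := Set.mem_iUnion₂.1
      (hUV.subset (isOpen_biUnion fun F _ => hEo F) hzU)
    exact ⟨F, fun q hq => Set.mem_iInter₂.1 hzF q hq, hNp.mono hFN hpG'⟩

/-- A continuous extension of `φ` is proximal, provided `φ` is. -/
theorem proximal_of_extension {S : Set (Set X)} (hS : ∀ p ∈ S, IsOpen p) {ι : Y → Z}
    (hι : Continuous ι) (hZ : StablyLocallyCompact Z)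
    (hD : @Dense Z (patchTopology Z) (Set.range ι)) {φ : Y → X} (hφ : Proximal φ)
    {ψ : Z → TightSpec (subCover S)} (hψ : Continuous ψ)
    (h : ∀ y, (ψ (ι y)).pts = {p : S | φ y ∈ (p : Set X)}) : Proximal ψ := by
  refine ⟨hψ, fun O N _ hN hON => ?_⟩
  obtain ⟨𝒱, h𝒱, hsub⟩ := hON.exists_finset
    (P := fun v => CompactlyContained (ψ ⁻¹' v) (ψ ⁻¹' N)) fun T hT => by
      obtain ⟨F, hF, hTF, hFN⟩ := TightSpec.exists_TF_subset hN hT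
      choose! H hHT hHF using fun p (hp : p ∈ F) => T.exists_entails_of_mem (hTF hp)
      have hint : ∀ p ∈ F, TightSpec.TF (subCover S) (F.biUnion H) ⊆ TightSpec.TF _ (H p) :=
        fun p hp T' hT' q hq => hT' (Finset.mem_biUnion.2 ⟨p, hp, hq⟩)
      refine ⟨TightSpec.TF _ (F.biUnion H), TightSpec.isOpen_TF _, fun q hq => ?_, ?_⟩
      · obtain ⟨p, hp, hq⟩ := Finset.mem_biUnion.1 hq
        exact hHT p hp hq
      · refine (CompactlyContained.biInter_of_coreCoherent hZ.2.1
          (s := fun p : S => ψ ⁻¹' {T | p ∈ T.pts}) ((TightSpec.isOpen_TF _).preimage hψ)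
          (fun p => (TightSpec.isOpen_setOf_mem p).preimage hψ) hF fun p hp => ?_).mono
          subset_rfl fun z hz => hFN fun p hp => Set.mem_iInter₂.1 hz p hp
        refine hφ.compactlyContained_of_trace hZ.1 hZ.2.2 hι hD
          ((TightSpec.isOpen_TF _).preimage hψ) (O := ⋂ q ∈ H p, (q : Set X))
          (N := p) (isOpen_biInter_finset fun q _ => hS q q.2) (hS p p.2)
          ((hHF p hp).mono subset_rfl (by simp)) (fun y hy => ?_) fun y hy => ?_
        · refine Set.mem_iInter₂.2 fun q hq => ?_
          have hq' : q ∈ (ψ (ι y)).pts := hint p hp hy hq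
          rw [h] at hq'
          exact hq'
        · change p ∈ (ψ (ι y)).pts
          rw [h]
          exact hy
  refine CompactlyContained.mono (CompactlyContained.sUnion (𝒱 := 𝒱.image (ψ ⁻¹' ·))
    fun t ht => ?_) (fun z hz => ?_) subset_rfl
  · obtain ⟨v, hv, rfl⟩ := Finset.mem_image.1 ht
    exact (h𝒱 v hv).2
  · obtain ⟨v, hv, hzv⟩ := hsub hz
    exact ⟨ψ ⁻¹' v, Finset.mem_image_of_mem (ψ ⁻¹' ·) hv, hzv⟩

/-- Continuous extensions of a proximal map are pointwise comparable. -/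
theorem pts_subset_of_extensions {S : Set (Set X)} (hS : ∀ p ∈ S, IsOpen p) {ι : Y → Z}
    (hι : Continuous ι) (hZ : CoreCompact Z) (hs : SoberSpace Z)
    (hD : @Dense Z (patchTopology Z) (Set.range ι)) {φ : Y → X} (hφ : Proximal φ)
    {ψ ψ' : Z → TightSpec (subCover S)} (hψ : Continuous ψ) (hψ' : Continuous ψ')
    (h : ∀ y, (ψ (ι y)).pts = {p : S | φ y ∈ (p : Set X)})
    (h' : ∀ y, (ψ' (ι y)).pts = {p : S | φ y ∈ (p : Set X)}) (z : Z) :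
    (ψ z).pts ⊆ (ψ' z).pts := by
  intro p hp
  obtain ⟨F, hF, hFp⟩ := (ψ z).exists_entails_of_mem hp
  have hopen := (TightSpec.isOpen_setOf_mem (r := subCover S) p).preimage hψ'
  have key : CompactlyContained (ψ ⁻¹' TightSpec.TF _ F) (ψ' ⁻¹' {T | p ∈ T.pts}) := by
    refine hφ.compactlyContained_of_trace hZ hs hι hD ((TightSpec.isOpen_TF _).preimage hψ)
      (O := ⋂ q ∈ F, (q : Set X)) (N := p) (isOpen_biInter_finset fun q _ => hS q q.2)
      (hS p p.2) (hFp.mono subset_rfl (by simp)) (fun y hy => ?_) fun y hy => ?_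
    · refine Set.mem_iInter₂.2 fun q hq => ?_
      have hq' : q ∈ (ψ (ι y)).pts := hy hq
      rw [h] at hq'
      exact hq'
    · change p ∈ (ψ' (ι y)).pts
      rw [h']
      exact hy
  exact key.subset hopen hF

end Extension

/-- **Minimal stabilisation.** -/
theorem minimal_stabilisation {X Y Z : Type*} [TopologicalSpace X] [TopologicalSpace Y]
    [TopologicalSpace Z] [T0Space X]
    (hX : CoreCompact X) (S : Set (Set X)) (hS : IsSubbasis S)
    (ι : Y → Z) (hι : Topology.IsEmbedding ι)
    (hZ : StablyLocallyCompact Z) (hYZ : VeryDense (Set.range ι))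
    (φ : Y → X) (hφ : Proximal φ) :
    ∃! ψ : Z → TightSpec (subCover S),
      Proximal ψ ∧ ∀ y : Y, (ψ (ι y)).pts = {p : ↥S | φ y ∈ (p : Set X)} := by
  have hE := fun p : S => preimage_extendedPreimage hX hι.isInducing hφ.1 (hS.1 p p.2)
  have hne : ∀ z : Z, {p : S | z ∈ extendedPreimage ι φ p}.Nonempty := by
    intro z
    obtain ⟨_, ⟨y, rfl⟩, hzy⟩ := hYZ.1.symm.subset (Set.mem_univ z)
    obtain ⟨p, hp, hyp⟩ := hS.2.1.symm.subset (Set.mem_univ (φ y))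
    exact ⟨⟨p, hp⟩, hzy _ (isOpen_extendedPreimage ι φ p) ((hE ⟨p, hp⟩).symm.subset hyp)⟩
  let ψ : Z → TightSpec (subCover S) := fun z => ⟨{p : S | z ∈ extendedPreimage ι φ p},
    tightSet_extendedPreimage hX hS hι.isInducing hZ.1 hZ.2.2 hYZ.2 hφ z, hne z⟩
  have hψ : Continuous ψ := continuous_generateFrom_iff.2 <| by
    rintro _ ⟨p, rfl⟩
    exact isOpen_extendedPreimage ι φ p
  have hψι : ∀ y : Y, (ψ (ι y)).pts = {p : S | φ y ∈ (p : Set X)} := fun y =>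
    Set.ext fun p => Set.ext_iff.1 (hE p) y
  refine ⟨ψ, ⟨proximal_of_extension hS.1 hι.continuous hZ hYZ.2 hφ hψ hψι, hψι⟩, ?_⟩
  rintro ψ' ⟨hψ', hψ'ι⟩
  funext z
  exact Subtype.ext (Set.Subset.antisymm
    (pts_subset_of_extensions hS.1 hι.continuous hZ.1 hZ.2.2 hYZ.2 hφ hψ'.1 hψ hψ'ι hψι z)
    (pts_subset_of_extensions hS.1 hι.continuous hZ.1 hZ.2.2 hYZ.2 hφ hψ hψ'.1 hψι hψ'ι z))
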